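/- Let n, m be nonzero integers, let α ∈ ℂ with α ≠ 2 and α ≠ −2, and let P ∈ ℂ[s,t,u] be the polynomial P = 2 + φ_{|n|}(s)²·φ_{|m|}(t)²·(s² + t² + u² − s·t·u − 4) (the trace polynomial of the word [xⁿ,yᵐ]). If (s₀,t₀,u₀) ∈ ℂ³ satisfies P(s₀,t₀,u₀) = α and all three partial derivatives ∂P/∂s, ∂P/∂t, ∂P/∂u vanish at (s₀,t₀,u₀), then: 2u₀ = s₀t₀; (s₀²−4)·φ_{|n|}'(s₀) + s₀·φ_{|n|}(s₀) = 0; (t₀²−4)·φ_{|m|}'(t₀) + t₀·φ_{|m|}(t₀) = 0; and α − 2 = −φ_{|n|}(s₀)²·φ_{|m|}(t₀)²·(s₀²−4)·(t₀²−4)/4. -/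

import Mathlib

open MvPolynomial

/-- `φ_k`, the Dickson polynomial of the second kind `E_{k-1}(X,1)`:
`φ_1 = 1`, `φ_2 = X`, `φ_{k+1} = X·φ_k − φ_{k−1}`. -/
noncomputable def phi (k : ℕ) : Polynomial ℂ := Polynomial.dickson 2 (1 : ℂ) (k - 1)

/-- necessary conditions at a singular point of the trace surface
`{P = α}` for `P` the trace polynomial of `[xⁿ,yᵐ]`. -/
theorem singular_point_conditions (n m : ℤ) (hn : n ≠ 0) (hm : m ≠ 0)
    (α : ℂ) (hα : α ≠ 2) (hα' : α ≠ -2)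
    (P : MvPolynomial (Fin 3) ℂ)
    (hP : P = C 2 +
        (Polynomial.aeval (X 0 : MvPolynomial (Fin 3) ℂ) (phi n.natAbs)) ^ 2 *
        (Polynomial.aeval (X 1 : MvPolynomial (Fin 3) ℂ) (phi m.natAbs)) ^ 2 *
        (X 0 ^ 2 + X 1 ^ 2 + X 2 ^ 2 - X 0 * X 1 * X 2 - 4))
    (s₀ t₀ u₀ : ℂ)
    (hval : eval ![s₀, t₀, u₀] P = α)
    (hds : eval ![s₀, t₀, u₀] (pderiv 0 P) = 0)
    (hdt : eval ![s₀, t₀, u₀] (pderiv 1 P) = 0)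
    (hdu : eval ![s₀, t₀, u₀] (pderiv 2 P) = 0) :
    2 * u₀ = s₀ * t₀ ∧
    (s₀ ^ 2 - 4) * Polynomial.eval s₀ (Polynomial.derivative (phi n.natAbs))
      + s₀ * Polynomial.eval s₀ (phi n.natAbs) = 0 ∧
    (t₀ ^ 2 - 4) * Polynomial.eval t₀ (Polynomial.derivative (phi m.natAbs))
      + t₀ * Polynomial.eval t₀ (phi m.natAbs) = 0 ∧
    α - 2 = -(Polynomial.eval s₀ (phi n.natAbs)) ^ 2 *
        (Polynomial.eval t₀ (phi m.natAbs)) ^ 2 *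
        (s₀ ^ 2 - 4) * (t₀ ^ 2 - 4) / 4 := by
  have key : ∀ (i : Fin 3) (p : Polynomial ℂ), eval ![s₀, t₀, u₀]
      (Polynomial.aeval (X i : MvPolynomial (Fin 3) ℂ) p) = Polynomial.eval (![s₀, t₀, u₀] i) p := by
    intro i p
    induction p using Polynomial.induction_on' with
    | add p q hp hq => simp [hp, hq]
    | monomial k c => simp [Polynomial.aeval_monomial, MvPolynomial.algebraMap_eq]
  have h4 : ∀ i : Fin 3, pderiv i (4 : MvPolynomial (Fin 3) ℂ) = 0 := by
    intro i
    have : (4 : MvPolynomial (Fin 3) ℂ) = C 4 := (map_ofNat C 4).symm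
    rw [this, pderiv_C]
  subst hP
  generalize phi n.natAbs = p at *
  generalize phi m.natAbs = q at *
  simp [key, Derivation.leibniz, Derivation.leibniz_pow, Derivation.map_aeval, pderiv_X, h4] at hval hds hdt hdu
  generalize Polynomial.eval s₀ (Polynomial.derivative p) = a' at *
  generalize Polynomial.eval t₀ (Polynomial.derivative q) = b' at *
  generalize Polynomial.eval s₀ p = a at *
  generalize Polynomial.eval t₀ q = b at *
  have hne : α - 2 ≠ 0 := sub_ne_zero.mpr hα
  have hv : α - 2 = a ^ 2 * b ^ 2 * (s₀ ^ 2 + t₀ ^ 2 + u₀ ^ 2 - s₀ * t₀ * u₀ - 4) := by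
    rw [← hval]; ring
  have ha : a ≠ 0 := by rintro rfl; apply hne; rw [hv]; ring
  have hb : b ≠ 0 := by rintro rfl; apply hne; rw [hv]; ring
  have hu : 2 * u₀ = s₀ * t₀ := by
    grind
  have hu' : u₀ = s₀ * t₀ / 2 := by rw [← hu]; ring
  subst hu'
  have hf : α - 2 = -a ^ 2 * b ^ 2 * (s₀ ^ 2 - 4) * (t₀ ^ 2 - 4) / 4 := by
    rw [hv]; ring
  have hs : s₀ ^ 2 - 4 ≠ 0 := by intro h; apply hne; rw [hf, h]; ring
  have ht : t₀ ^ 2 - 4 ≠ 0 := by intro h; apply hne; rw [hf, h]; ring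
  refine ⟨hu, ?_, ?_, hf⟩
  · have : a * b ^ 2 * (t₀ ^ 2 - 4) * ((s₀ ^ 2 - 4) * a' + s₀ * a) = 0 := by
      linear_combination (-2) * hds
    simpa [ha, hb, ht] using this
  · have : b * a ^ 2 * (s₀ ^ 2 - 4) * ((t₀ ^ 2 - 4) * b' + t₀ * b) = 0 := by
      linear_combination (-2) * hdt
    simpa [ha, hb, hs] using this
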